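/- Let a > 0 and 0 < b < 1 be real numbers. If m = m(N) and l = l(N) are sequences of positive integers with m/N → a and l/N → b as N → ∞, then the quantity F(N,m,l) = [ m·C(m+N,m)·C(m+N−1,m) / C(2m+2N−1,2m) ] · ∑_{e=0}^{l−1} (−1)^e C(N,e) (N−2e)(1/2)_e / ((m+e)(m+N−e)(1/2−N)_e) converges to (2/π)·arcsin( √(b(1−b)) / √((a+b)(a−b+1)) ) as N → ∞. -/

import Mathlib

/-- The shifted factorial (Pochhammer symbol) `(x)_k = x(x+1)⋯(x+k-1)`. -/
noncomputable def poch (x : ℝ) (k : ℕ) : ℝ := ∏ t ∈ Finset.range k, (x + t)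

/-- The proportion of rhombus tilings of a hexagon with sides `N,2m,N,N,2m,N`
containing the `l`-th rhombus on the symmetry axis. -/
noncomputable def F (N m l : ℕ) : ℝ :=
  ((m : ℝ) * ((m + N).choose m : ℝ) * ((m + N - 1).choose m : ℝ) /
      ((2 * m + 2 * N - 1).choose (2 * m) : ℝ)) *
    ∑ e ∈ Finset.range l,
      (-1 : ℝ) ^ e * (N.choose e : ℝ) * ((N : ℝ) - 2 * e) * poch (1 / 2) e /
        (((m : ℝ) + e) * ((m : ℝ) + N - e) * poch (1 / 2 - (N : ℝ)) e)

open Filter Topology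
open scoped Nat

/-- The central binomial coefficient normalised by its order of growth, `C(2n,n) / 4^n`. -/
noncomputable def centralRatio (n : ℕ) : ℝ := (n.centralBinom : ℝ) / 4 ^ n

lemma centralRatio_pos (n : ℕ) : 0 < centralRatio n := by
  have := n.centralBinom_pos
  unfold centralRatio
  positivity

lemma centralRatio_eq_factorial (n : ℕ) :
    centralRatio n = ((2 * n)! : ℝ) / ((n ! : ℝ) ^ 2 * 4 ^ n) := by
  rw [centralRatio, Nat.centralBinom_eq_two_mul_choose, two_mul, Nat.cast_add_choose]
  rw [div_div, sq]

lemma centralRatio_succ (n : ℕ) :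
    centralRatio (n + 1) = centralRatio n * ((2 * n + 1) / (2 * n + 2)) := by
  have h : ((n : ℝ) + 1) * (n + 1).centralBinom = 2 * (2 * n + 1) * n.centralBinom := by
    exact_mod_cast Nat.succ_mul_centralBinom_succ n
  unfold centralRatio
  have : (n : ℝ) + 1 ≠ 0 := by positivity
  field_simp
  rw [pow_succ]
  linear_combination 2 * h * 4 ^ n

lemma centralRatio_mul_sqrt_succ_le_one (n : ℕ) : centralRatio n * √(n + 1) ≤ 1 := by
  have h : centralRatio n ^ 2 * (n + 1) ≤ 1 := by
    induction n with
    | zero => simp [centralRatio]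
    | succ n ih =>
      rw [centralRatio_succ]
      have : ((2 * n + 1 : ℝ) / (2 * n + 2)) ^ 2 * (n + 1 + 1) ≤ n + 1 := by
        rw [div_pow, div_mul_eq_mul_div, div_le_iff₀ (by positivity)]
        nlinarith [(n.cast_nonneg : (0 : ℝ) ≤ n)]
      calc _ = centralRatio n ^ 2 * (((2 * n + 1 : ℝ) / (2 * n + 2)) ^ 2 * (n + 1 + 1)) := by
            push_cast; ring
        _ ≤ centralRatio n ^ 2 * (n + 1) := by gcongr
        _ ≤ 1 := ih
  have := centralRatio_pos n
  rw [← sq_le_one_iff₀ (by positivity), mul_pow, Real.sq_sqrt (by positivity)]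
  exact h

lemma tendsto_centralRatio_mul_sqrt :
    Tendsto (fun n : ℕ => centralRatio n * √n) atTop (𝓝 (√Real.pi)⁻¹) := by
  have h := Stirling.tendsto_stirlingSeq_sqrt_pi
  have h2 : Tendsto (fun n : ℕ => Stirling.stirlingSeq (2 * n)) atTop (𝓝 (√Real.pi)) :=
    h.comp (tendsto_id.const_mul_atTop' two_pos)
  have hpi : √Real.pi ≠ 0 := by positivity
  have h3 := h2.div (h.pow 2) (by positivity)
  have e : √Real.pi / √Real.pi ^ 2 = (√Real.pi)⁻¹ := by field_simp
  rw [e] at h3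
  refine h3.congr' ?_
  filter_upwards [eventually_gt_atTop 0] with n hn
  have hn' : (0 : ℝ) < n := by exact_mod_cast hn
  simp only [Pi.div_apply, Stirling.stirlingSeq, centralRatio_eq_factorial]
  have s1 : √(2 * ((2 * n : ℕ) : ℝ)) = 2 * √n := by
    rw [show 2 * ((2 * n : ℕ) : ℝ) = 2 ^ 2 * n by push_cast; ring, Real.sqrt_mul (by positivity),
      Real.sqrt_sq (by positivity)]
  have s2 : √(2 * (n : ℝ)) ^ 2 = 2 * (√n * √n) := by
    rw [Real.sq_sqrt (by positivity), Real.mul_self_sqrt (by positivity)]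
  have s3 : ((2 * n : ℕ) / Real.exp 1 : ℝ) ^ (2 * n) = 4 ^ n * ((n / Real.exp 1 : ℝ) ^ n) ^ 2 := by
    rw [pow_mul, ← pow_mul _ n 2, mul_comm n 2, pow_mul, ← mul_pow]
    push_cast
    ring
  have : √(n : ℝ) ≠ 0 := by positivity
  rw [s1, s3]
  simp only [div_pow, mul_pow, s2]
  field_simp

lemma poch_succ (x : ℝ) (k : ℕ) : poch x (k + 1) = poch x k * (x + k) :=
  Finset.prod_range_succ _ _

lemma poch_half_eq (n : ℕ) : poch (1 / 2) n = n ! * centralRatio n := by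
  induction n with
  | zero => simp [poch, centralRatio]
  | succ n ih =>
    rw [poch_succ, ih, centralRatio_succ, Nat.factorial_succ]
    have : (2 * n + 2 : ℝ) ≠ 0 := by positivity
    push_cast
    field_simp
    ring

lemma neg_one_pow_mul_poch_half_sub {N e : ℕ} (h : e ≤ N) :
    (-1) ^ e * poch (1 / 2 - N) e * poch (1 / 2) (N - e) = poch (1 / 2) N := by
  induction e with
  | zero => simp [poch]
  | succ e ih =>
    rw [← ih (by omega), show N - e = (N - (e + 1)) + 1 by omega, poch_succ, poch_succ,
      Nat.cast_sub h]
    push_cast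
    ring

lemma choose_mul_poch_div_poch {N e : ℕ} (h : e ≤ N) :
    (-1 : ℝ) ^ e * (N.choose e : ℝ) * poch (1 / 2) e / poch (1 / 2 - (N : ℝ)) e =
      centralRatio e * centralRatio (N - e) / centralRatio N := by
  have h1 := neg_one_pow_mul_poch_half_sub h
  have hs : ((-1 : ℝ) ^ e) * (-1) ^ e = 1 := by rw [← mul_pow]; simp
  simp only [poch_half_eq] at h1 ⊢
  have c1 := centralRatio_pos N
  have c2 := centralRatio_pos (N - e)
  have hp : poch (1 / 2 - (N : ℝ)) e ≠ 0 := by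
    intro h0
    rw [h0] at h1
    have : (0 : ℝ) < N ! * centralRatio N := by positivity
    simp at h1
    rcases h1 with h1 | h1
    · exact absurd h1 (Nat.factorial_ne_zero N)
    · exact c1.ne' h1
  have hc : (N.choose e : ℝ) * e ! * (N - e)! = N ! := by
    exact_mod_cast Nat.choose_mul_factorial_mul_factorial h
  have hN : (N ! : ℝ) ≠ 0 := by positivity
  have hNe : ((N - e)! : ℝ) ≠ 0 := by positivity
  rw [div_eq_div_iff hp c1.ne']
  apply mul_left_cancel₀ hN
  calc _ = (-1) ^ e * (N.choose e : ℝ) * e ! * centralRatio e * (N ! * centralRatio N) := by ring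
    _ = ((-1) ^ e * (-1) ^ e) * ((N.choose e : ℝ) * e ! * (N - e)!) *
      (centralRatio e * centralRatio (N - e) * poch (1 / 2 - (N : ℝ)) e) := by rw [← h1]; ring
    _ = _ := by rw [hs, hc]; ring

lemma prefactor_eq (m : ℕ) {N : ℕ} (hN : 0 < N) :
    (m : ℝ) * ((m + N).choose m : ℝ) * ((m + N - 1).choose m : ℝ) /
      ((2 * m + 2 * N - 1).choose (2 * m) : ℝ) =
    m * centralRatio m * centralRatio N / centralRatio (m + N) := by
  obtain ⟨n, rfl⟩ : ∃ n, N = n + 1 := ⟨N - 1, by omega⟩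
  rw [show m + (n + 1) - 1 = m + n by omega,
    show 2 * m + 2 * (n + 1) - 1 = 2 * m + (2 * n + 1) by omega]
  simp only [Nat.cast_add_choose, centralRatio_eq_factorial]
  rw [show 2 * (m + (n + 1)) = 2 * m + (2 * n + 1) + 1 by ring,
    show 2 * (n + 1) = (2 * n + 1) + 1 by ring, ← add_assoc m n 1]
  simp only [Nat.factorial_succ (2 * m + (2 * n + 1)), Nat.factorial_succ (2 * n + 1),
    Nat.factorial_succ (m + n), Nat.factorial_succ n]
  push_cast
  have : (m : ℝ) + n + 1 ≠ 0 := by positivity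
  have : (n : ℝ) + 1 ≠ 0 := by positivity
  have : (2 * n + 1 : ℝ) + 1 ≠ 0 := by positivity
  have : (2 * m + (2 * n + 1) : ℝ) + 1 ≠ 0 := by positivity
  field_simp
  ring

/-- The summand of `F` without its `e`-independent prefactor. -/
noncomputable def summand (N m e : ℕ) : ℝ :=
  m * centralRatio e * centralRatio (N - e) * ((N : ℝ) - 2 * e) /
    (((m : ℝ) + e) * ((m : ℝ) + N - e))

lemma F_eq {N m l : ℕ} (hN : 0 < N) (hl : l ≤ N) :
    F N m l =
      centralRatio m / centralRatio (m + N) * ∑ e ∈ Finset.range l, summand N m e := by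
  rw [F, prefactor_eq m hN, Finset.mul_sum, Finset.mul_sum]
  refine Finset.sum_congr rfl fun e he => ?_
  have heN : e ≤ N := by have := Finset.mem_range.1 he; omega
  have h := choose_mul_poch_div_poch heN
  have := (centralRatio_pos N).ne'
  calc _ = m * centralRatio m * centralRatio N / centralRatio (m + N) *
      (((N : ℝ) - 2 * e) / (((m : ℝ) + e) * ((m : ℝ) + N - e))) *
      ((-1 : ℝ) ^ e * (N.choose e : ℝ) * poch (1 / 2) e / poch (1 / 2 - (N : ℝ)) e) := by
        simp only [div_eq_mul_inv, mul_inv]; ring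
    _ = _ := by rw [h, summand]; field_simp

lemma sum_range_eq_integral_ceil (g : ℕ → ℝ) {N : ℕ} (hN : 0 < N) :
    ∑ e ∈ Finset.range N, g e = ∫ t in (0 : ℝ)..1, N * g (⌈N * t⌉₊ - 1) := by
  have key : ∀ k : ℕ, Set.EqOn (fun _ : ℝ => g k) (fun x : ℝ => g (⌈x⌉₊ - 1))
      (Set.uIoc (k : ℝ) (k + 1 : ℕ)) := by
    intro k x hx
    rw [Set.uIoc_of_le (by simp)] at hx
    have : ⌈x⌉₊ = k + 1 := by
      rw [Nat.ceil_eq_iff (by omega)]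
      simpa using hx
    simp [this]
  have h := intervalIntegral.sum_integral_adjacent_intervals (μ := MeasureTheory.volume)
    (f := fun x : ℝ => g (⌈x⌉₊ - 1)) (a := fun k : ℕ => (k : ℝ)) (n := N) fun k _ =>
      (intervalIntegrable_congr (key k)).1 intervalIntegrable_const
  have hN' : (N : ℝ) ≠ 0 := by positivity
  rw [intervalIntegral.integral_const_mul,
    intervalIntegral.integral_comp_mul_left (fun x : ℝ => g (⌈x⌉₊ - 1)) hN', smul_eq_mul,
    mul_inv_cancel_left₀ hN', mul_zero, mul_one, ← Nat.cast_zero, ← h]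
  refine Finset.sum_congr rfl fun k _ => ?_
  rw [← intervalIntegral.integral_congr_ae (Eventually.of_forall fun x hx => key k hx)]
  simp

section Density

variable {a b : ℝ}

lemma intervalIntegrable_arcsine_density (ha : 0 < a) (hb0 : 0 < b) (hb1 : b < 1) :
    IntervalIntegrable (fun t => (1 - 2 * t) / (√t * √(1 - t) * ((a + t) * (a + 1 - t))))
      MeasureTheory.volume 0 b := by
  have h := (intervalIntegral.intervalIntegrable_rpow' (a := 0) (b := b)
    (show (-1 : ℝ) < -(1 / 2) by norm_num)).mul_continuousOn
    (g := fun t => (1 - 2 * t) / (√(1 - t) * ((a + t) * (a + 1 - t)))) ?_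
  · refine h.congr ?_
    intro t ht
    rw [Set.uIoc_of_le hb0.le] at ht
    simp only
    rw [Real.rpow_neg ht.1.le, ← Real.sqrt_eq_rpow]
    simp only [div_eq_mul_inv, mul_inv]
    ring
  · rw [Set.uIcc_of_le hb0.le]
    refine ContinuousOn.div (by fun_prop) (by fun_prop) fun t ht => ?_
    have h1 : 0 < 1 - t := by linarith [ht.2]
    have h2 : 0 < a + t := by linarith [ht.1]
    have h3 : 0 < a + 1 - t := by linarith
    positivity

lemma integral_arcsine_density (ha : 0 < a) (hb0 : 0 < b) (hb1 : b < 1) :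
    ∫ t in (0 : ℝ)..b, (1 - 2 * t) / (√t * √(1 - t) * ((a + t) * (a + 1 - t))) =
      2 / √(a * (a + 1)) * Real.arctan (√(b * (1 - b)) / √(a * (a + 1))) := by
  have hK : 0 < √(a * (a + 1)) := by positivity
  have hK2 : √(a * (a + 1)) ^ 2 = a * (a + 1) := Real.sq_sqrt (by positivity)
  rw [intervalIntegral.integral_eq_sub_of_hasDerivAt_of_le hb0.le
    (f := fun t => 2 / √(a * (a + 1)) * Real.arctan (√(t * (1 - t)) / √(a * (a + 1))))
    ?_ ?_ (intervalIntegrable_arcsine_density ha hb0 hb1)]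
  · simp
  · exact Continuous.continuousOn (by fun_prop)
  · intro t ht
    have h0 : 0 < t := ht.1
    have h1 : 0 < 1 - t := by linarith [ht.2]
    have hd : HasDerivAt (fun t : ℝ => t * (1 - t)) (1 - 2 * t) t := by
      refine ((hasDerivAt_id' t).mul ((hasDerivAt_id' t).const_sub 1)).congr_deriv ?_
      ring
    have hs := hd.sqrt (by positivity)
    refine (((hs.div_const √(a * (a + 1))).arctan).const_mul (2 / √(a * (a + 1)))).congr_deriv ?_
    have h2 : 0 < a + t := by linarith
    have h3 : 0 < a + 1 - t := by linarith
    have e : 1 + (√(t * (1 - t)) / √(a * (a + 1))) ^ 2 =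
        (a + t) * (a + 1 - t) / √(a * (a + 1)) ^ 2 := by
      rw [div_pow, hK2, Real.sq_sqrt (by positivity)]
      field_simp
      ring
    rw [e, Real.sqrt_mul h0.le]
    field_simp

lemma arctan_eq_arcsin_sqrt_div (ha : 0 < a) (hb0 : 0 < b) (hb1 : b < 1) :
    Real.arctan (√(b * (1 - b)) / √(a * (a + 1))) =
      Real.arcsin (√(b * (1 - b)) / √((a + b) * (a - b + 1))) := by
  have h1 : 0 < 1 - b := by linarith
  have h3 : 0 < a - b + 1 := by linarith
  rw [Real.arctan_eq_arcsin, div_pow, Real.sq_sqrt (by positivity), Real.sq_sqrt (by positivity),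
    div_div, ← Real.sqrt_mul (by positivity)]
  congr 3
  field_simp
  ring

end Density

lemma tendsto_natCast_atTop_of_div {u : ℕ → ℕ} {c : ℝ} (hc : 0 < c)
    (h : Tendsto (fun N : ℕ => (u N : ℝ) / N) atTop (𝓝 c)) : Tendsto u atTop atTop := by
  rw [← tendsto_natCast_atTop_iff (R := ℝ)]
  refine (h.pos_mul_atTop hc tendsto_natCast_atTop_atTop).congr' ?_
  filter_upwards [eventually_gt_atTop 0] with N hN
  have : (N : ℝ) ≠ 0 := by positivity
  field_simp

lemma tendsto_centralRatio_mul_sqrt_self {u : ℕ → ℕ} {c : ℝ} (hc : 0 < c)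
    (h : Tendsto (fun N : ℕ => (u N : ℝ) / N) atTop (𝓝 c)) :
    Tendsto (fun N : ℕ => centralRatio (u N) * √N) atTop (𝓝 ((√Real.pi)⁻¹ / √c)) := by
  have h1 := tendsto_centralRatio_mul_sqrt.comp (tendsto_natCast_atTop_of_div hc h)
  have hc' : √c ≠ 0 := by positivity
  refine (h1.div h.sqrt hc').congr' ?_
  filter_upwards [eventually_gt_atTop 0, h.eventually (lt_mem_nhds hc)] with N hN hu
  have h2 : (0 : ℝ) < N := by positivity
  have h3 : (0 : ℝ) < u N := by
    by_contra h4
    have := div_nonpos_of_nonpos_of_nonneg (not_lt.1 h4) h2.le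
    linarith
  have : √(u N : ℝ) ≠ 0 := by positivity
  have : √(N : ℝ) ≠ 0 := by positivity
  simp only [Pi.div_apply, Function.comp]
  rw [Real.sqrt_div (by positivity)]
  field_simp

lemma tendsto_centralRatio_div {a : ℝ} (ha : 0 < a) {m : ℕ → ℕ}
    (hma : Tendsto (fun N : ℕ => (m N : ℝ) / N) atTop (𝓝 a)) :
    Tendsto (fun N : ℕ => centralRatio (m N) / centralRatio (m N + N)) atTop
      (𝓝 (√(a + 1) / √a)) := by
  have h1 : Tendsto (fun N : ℕ => ((m N + N : ℕ) : ℝ) / N) atTop (𝓝 (a + 1)) := by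
    refine (hma.add_const 1).congr' ?_
    filter_upwards [eventually_gt_atTop 0] with N hN
    have : (N : ℝ) ≠ 0 := by positivity
    push_cast
    field_simp
  have ha1 : 0 < a + 1 := by linarith
  have h2 := (tendsto_centralRatio_mul_sqrt_self ha hma).div
    (tendsto_centralRatio_mul_sqrt_self ha1 h1) (by positivity)
  have e : (√Real.pi)⁻¹ / √a / ((√Real.pi)⁻¹ / √(a + 1)) = √(a + 1) / √a := by
    have : √a ≠ 0 := by positivity
    have : √(a + 1) ≠ 0 := by positivity
    have := Real.pi_pos
    field_simp
  rw [e] at h2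
  refine h2.congr' ?_
  filter_upwards [eventually_gt_atTop 0] with N hN
  have : √(N : ℝ) ≠ 0 := by positivity
  simp only [Pi.div_apply]
  rw [mul_div_mul_right _ _ this]

lemma tendsto_mul_summand {a t : ℝ} (ha : 0 < a) (ht0 : 0 < t) (ht1 : t < 1) {m e : ℕ → ℕ}
    (hm : Tendsto (fun N : ℕ => (m N : ℝ) / N) atTop (𝓝 a))
    (he : Tendsto (fun N : ℕ => (e N : ℝ) / N) atTop (𝓝 t)) :
    Tendsto (fun N : ℕ => N * summand N (m N) (e N)) atTop
      (𝓝 (a / Real.pi * ((1 - 2 * t) / (√t * √(1 - t) * ((a + t) * (a + 1 - t)))))) := by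
  have h1 : 0 < 1 - t := by linarith
  have heN : ∀ᶠ N : ℕ in atTop, e N ≤ N := by
    filter_upwards [eventually_gt_atTop 0, he.eventually (gt_mem_nhds ht1)] with N hN h
    rw [div_lt_one (by positivity)] at h
    exact_mod_cast h.le
  have hNe : Tendsto (fun N : ℕ => ((N - e N : ℕ) : ℝ) / N) atTop (𝓝 (1 - t)) := by
    refine (he.const_sub 1).congr' ?_
    filter_upwards [eventually_gt_atTop 0, heN] with N hN h
    have : (N : ℝ) ≠ 0 := by positivity
    rw [Nat.cast_sub h]
    field_simp
  have hden : (a + t) * (a + 1 - t) ≠ 0 := by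
    have : 0 < a + 1 - t := by linarith
    positivity
  have hlim := ((hm.mul (tendsto_centralRatio_mul_sqrt_self ht0 he)).mul
    (tendsto_centralRatio_mul_sqrt_self h1 hNe)).mul
    (((he.const_mul 2).const_sub 1).div ((hm.add he).mul ((hm.add_const 1).sub he)) hden)
  have hval : a * ((√Real.pi)⁻¹ / √t) * ((√Real.pi)⁻¹ / √(1 - t)) *
      ((1 - 2 * t) / ((a + t) * (a + 1 - t))) =
      a / Real.pi * ((1 - 2 * t) / (√t * √(1 - t) * ((a + t) * (a + 1 - t)))) := by
    nth_rw 3 [← Real.mul_self_sqrt Real.pi_pos.le]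
    simp only [div_eq_mul_inv, mul_inv]
    ring
  rw [hval] at hlim
  refine hlim.congr' ?_
  filter_upwards [eventually_gt_atTop 0] with N hN
  have hN' : (N : ℝ) ≠ 0 := by positivity
  simp only [Pi.div_apply, summand]
  have e1 : (m N / N + e N / N : ℝ) * (m N / N + 1 - e N / N) =
      ((m N + e N) * (m N + N - e N)) / (N * N) := by field_simp
  have e2 : (1 - 2 * (e N / N) : ℝ) = (N - 2 * e N) / N := by field_simp
  rw [e1, e2]
  calc _ = m N / N * (centralRatio (e N) * centralRatio (N - e N)) * (√N * √N) *
      ((N - 2 * e N) / N / ((m N + e N) * (m N + N - e N) / (N * N))) := by ring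
    _ = _ := by
      rw [Real.mul_self_sqrt (by positivity)]
      field_simp

lemma abs_mul_summand_le {N m e : ℕ} {t δ : ℝ} (hN : 0 < N) (hm : 0 < m) (ht : 0 < t)
    (hδ : 0 < δ) (het : N * t ≤ e + 1) (heδ : e ≤ (1 - δ) * N) :
    |N * summand N m e| ≤ N / m * (√δ)⁻¹ * t ^ (-(1 / 2) : ℝ) := by
  have hN' : (0 : ℝ) < N := by positivity
  have hm' : (0 : ℝ) < m := by positivity
  have heN' : (e : ℝ) ≤ N := by nlinarith
  have heN : e ≤ N := by exact_mod_cast heN'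
  have bound : ∀ (k : ℕ) (x : ℝ), 0 < x → N * x ≤ k + 1 →
      centralRatio k ≤ (√N)⁻¹ * (√x)⁻¹ := by
    intro k x hx hk
    rw [← mul_inv, ← Real.sqrt_mul hN'.le, ← one_div, le_div_iff₀ (by positivity)]
    refine le_trans ?_ (centralRatio_mul_sqrt_succ_le_one k)
    have := (centralRatio_pos k).le
    gcongr
  have b1 := bound e t ht het
  have b2 := bound (N - e) δ hδ (by rw [Nat.cast_sub heN]; linarith)
  have p1 := centralRatio_pos e
  have p2 := centralRatio_pos (N - e)
  have b3 : |(N : ℝ) - 2 * e| ≤ N := by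
    rw [abs_le]
    constructor <;> linarith [(e.cast_nonneg : (0 : ℝ) ≤ e)]
  have d1 : (m : ℝ) ≤ m + e := by simp
  have d2 : (m : ℝ) ≤ m + N - e := by linarith
  have d3 : (0 : ℝ) < (m + e) * (m + N - e) := by
    have : (0 : ℝ) < m + N - e := by linarith
    positivity
  rw [summand, abs_mul, abs_div, abs_mul, abs_of_pos hN', abs_of_pos d3,
    abs_of_pos (by positivity : 0 < m * centralRatio e * centralRatio (N - e)),
    Real.rpow_neg ht.le, ← Real.sqrt_eq_rpow]
  calc (N : ℝ) * (m * centralRatio e * centralRatio (N - e) * |(N : ℝ) - 2 * e| /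
        ((m + e) * (m + N - e)))
      ≤ N * (m * ((√N)⁻¹ * (√t)⁻¹) * ((√N)⁻¹ * (√δ)⁻¹) * N / (m * m)) := by gcongr
    _ = N * N / m * ((√N * √N)⁻¹) * (√δ)⁻¹ * (√t)⁻¹ := by
        field_simp
    _ = _ := by
        rw [Real.mul_self_sqrt hN'.le]
        field_simp

lemma tendsto_sum_summand {a b : ℝ} (ha : 0 < a) (hb0 : 0 < b) (hb1 : b < 1) {m l : ℕ → ℕ}
    (hm : ∀ N, 0 < m N)
    (hma : Tendsto (fun N : ℕ => (m N : ℝ) / N) atTop (𝓝 a))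
    (hlb : Tendsto (fun N : ℕ => (l N : ℝ) / N) atTop (𝓝 b)) :
    Tendsto (fun N : ℕ => ∑ e ∈ Finset.range (l N), summand N (m N) e) atTop
      (𝓝 (∫ t in (0 : ℝ)..b,
        a / Real.pi * ((1 - 2 * t) / (√t * √(1 - t) * ((a + t) * (a + 1 - t)))))) := by
  set density : ℝ → ℝ := fun t =>
    a / Real.pi * ((1 - 2 * t) / (√t * √(1 - t) * ((a + t) * (a + 1 - t))))
  obtain ⟨δ, hδ, hbδ⟩ : ∃ δ : ℝ, 0 < δ ∧ b < 1 - δ := ⟨(1 - b) / 2, by linarith, by linarith⟩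
  have hlδ : ∀ᶠ N : ℕ in atTop, (l N : ℝ) ≤ (1 - δ) * N := by
    filter_upwards [eventually_gt_atTop 0, hlb.eventually (gt_mem_nhds hbδ)] with N hN h
    rw [div_lt_iff₀ (by positivity)] at h
    exact h.le
  have hindicator : ∫ t in (0 : ℝ)..b, density t = ∫ t in (0 : ℝ)..1, (Set.Iic b).indicator density t := by
    rw [intervalIntegral.integral_of_le hb0.le, intervalIntegral.integral_of_le zero_le_one,
      MeasureTheory.setIntegral_indicator measurableSet_Iic, Set.Ioc_inter_Iic, min_eq_right hb1.le]
  rw [hindicator]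
  have hsum : ∀ᶠ N : ℕ in atTop,
      ∫ t in (0 : ℝ)..1, (N : ℝ) *
        (if ⌈N * t⌉₊ - 1 < l N then summand N (m N) (⌈N * t⌉₊ - 1) else 0) =
      ∑ e ∈ Finset.range (l N), summand N (m N) e := by
    filter_upwards [eventually_gt_atTop 0, hlδ] with N hN h
    have hlN : l N ≤ N := by
      have : (l N : ℝ) ≤ N := by nlinarith [(N.cast_nonneg : (0 : ℝ) ≤ N)]
      exact_mod_cast this
    rw [← sum_range_eq_integral_ceil (fun e => if e < l N then summand N (m N) e else 0) hN,
      ← Finset.sum_filter]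
    congr 1
    ext e
    simp only [Finset.mem_filter, Finset.mem_range]
    omega
  refine Tendsto.congr' hsum ?_
  refine intervalIntegral.tendsto_integral_filter_of_dominated_convergence
    (fun t => 2 / a * (√δ)⁻¹ * t ^ (-(1 / 2) : ℝ)) ?_ ?_ ?_ ?_
  · refine Eventually.of_forall fun N => Measurable.aestronglyMeasurable ?_
    have : Measurable fun t : ℝ => ⌈N * t⌉₊ := Nat.measurable_ceil.comp (measurable_const_mul _)
    exact (measurable_from_nat (f := fun k => (N : ℝ) *
      (if k - 1 < l N then summand N (m N) (k - 1) else 0))).comp this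
  · have hma' := (hma.inv₀ ha.ne').eventually (gt_mem_nhds
      (show a⁻¹ < 2 / a by rw [inv_eq_one_div]; gcongr; norm_num))
    filter_upwards [eventually_gt_atTop 0, hlδ, hma'] with N hN hl h
    refine Eventually.of_forall fun t ht => ?_
    rw [Set.uIoc_of_le zero_le_one] at ht
    have ht0 := ht.1
    rw [inv_div] at h
    rw [Real.norm_eq_abs]
    split_ifs with hlt
    · have hceil : 0 < ⌈N * t⌉₊ := Nat.ceil_pos.2 (by positivity)
      have hcast : ((⌈N * t⌉₊ - 1 : ℕ) : ℝ) + 1 = ⌈N * t⌉₊ := by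
        exact_mod_cast Nat.sub_add_cancel hceil
      refine (abs_mul_summand_le hN (hm N) ht0 hδ ?_ ?_).trans ?_
      · rw [hcast]
        exact Nat.le_ceil _
      · exact (Nat.cast_le.2 hlt.le).trans hl
      · gcongr
    · simp only [mul_zero, abs_zero]
      positivity
  · exact (intervalIntegral.intervalIntegrable_rpow' (by norm_num)).const_mul _
  · have hne : ∀ c : ℝ, ∀ᵐ t : ℝ, t ≠ c := fun c => by
      simp [MeasureTheory.ae_iff]
    filter_upwards [hne b, hne 1] with t htb ht1 ht
    rw [Set.uIoc_of_le zero_le_one] at ht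
    have ht0 := ht.1
    have he : Tendsto (fun N : ℕ => ((⌈N * t⌉₊ - 1 : ℕ) : ℝ) / N) atTop (𝓝 t) := by
      have h := ((tendsto_nat_ceil_mul_div_atTop ht0.le).comp
        (tendsto_natCast_atTop_atTop (R := ℝ))).sub (tendsto_one_div_atTop_nhds_zero_nat (𝕜 := ℝ))
      rw [sub_zero] at h
      refine h.congr' ?_
      filter_upwards [eventually_gt_atTop 0] with N hN
      have hceil : 0 < ⌈N * t⌉₊ := Nat.ceil_pos.2 (by positivity)
      rw [Nat.cast_sub hceil, Nat.cast_one, sub_div, Function.comp, mul_comm t]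
    have hcmp := hlb.sub he
    rcases lt_or_gt_of_ne htb with hlt | hgt
    · rw [Set.indicator_of_mem (Set.mem_Iic.2 hlt.le)]
      refine (tendsto_mul_summand ha ht0 (lt_of_le_of_ne ht.2 ht1) hma he).congr' ?_
      filter_upwards [eventually_gt_atTop 0,
        hcmp.eventually (lt_mem_nhds (sub_pos.2 hlt))] with N hN h
      rw [← sub_div, div_pos_iff_of_pos_right (by positivity), sub_pos, Nat.cast_lt] at h
      rw [if_pos h]
    · rw [Set.indicator_of_notMem (by simpa using hgt)]
      refine tendsto_const_nhds.congr' ?_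
      filter_upwards [eventually_gt_atTop 0,
        hcmp.eventually (gt_mem_nhds (sub_neg.2 hgt))] with N hN h
      rw [← sub_div, div_lt_iff₀ (by positivity), zero_mul, sub_neg, Nat.cast_lt] at h
      rw [if_neg h.not_gt, mul_zero]

/-- The arcsine law: if `m(N)/N → a > 0` and `l(N)/N → b ∈ (0,1)`, then
`F(N, m(N), l(N)) → (2/π)·arcsin(√(b(1−b))/√((a+b)(a−b+1)))`. -/
theorem arcsine_law (a b : ℝ) (ha : 0 < a) (hb0 : 0 < b) (hb1 : b < 1)
    (m l : ℕ → ℕ) (hm : ∀ N, 0 < m N) (hl : ∀ N, 0 < l N)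
    (hma : Filter.Tendsto (fun N : ℕ => (m N : ℝ) / N) Filter.atTop (nhds a))
    (hlb : Filter.Tendsto (fun N : ℕ => (l N : ℝ) / N) Filter.atTop (nhds b)) :
    Filter.Tendsto (fun N : ℕ => F N (m N) (l N)) Filter.atTop
      (nhds (2 / Real.pi *
        Real.arcsin (Real.sqrt (b * (1 - b)) / Real.sqrt ((a + b) * (a - b + 1))))) := by
  have h := (tendsto_centralRatio_div ha hma).mul
    (tendsto_sum_summand ha hb0 hb1 hm hma hlb)
  have hval : √(a + 1) / √a * (a / Real.pi * (2 / √(a * (a + 1)) *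
      Real.arcsin (√(b * (1 - b)) / √((a + b) * (a - b + 1))))) =
      2 / Real.pi * Real.arcsin (√(b * (1 - b)) / √((a + b) * (a - b + 1))) := by
    have : √(a + 1) ≠ 0 := by positivity
    have : √a ≠ 0 := by positivity
    have hs : √a ^ 2 = a := Real.sq_sqrt ha.le
    rw [Real.sqrt_mul ha.le]
    field_simp
    rw [hs]
  rw [intervalIntegral.integral_const_mul, integral_arcsine_density ha hb0 hb1,
    arctan_eq_arcsin_sqrt_div ha hb0 hb1, hval] at h
  refine h.congr' ?_
  filter_upwards [eventually_gt_atTop 0, hlb.eventually (gt_mem_nhds hb1)] with N hN hlN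
  rw [div_lt_one (by positivity), Nat.cast_lt] at hlN
  rw [F_eq hN hlN.le]
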